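/- Let (𝔤, g, J_g) and (𝔥, h, J_h) be pseudo-Kähler Lie algebras, φ : 𝔥 → Der(𝔤) a Lie algebra homomorphism with J_g∘φ(A)^s = φ(J_h A)^s and J_g∘φ(A)^a = φ(A)^a∘J_g for all A ∈ 𝔥, and suppose (𝔤 ⋊_φ 𝔥, g̃, J̃, Ẽ) is a hypersymplectic Lie algebra where Ẽ is block diagonal, Ẽ(X+A) = E₁X + E₄A with E₁ : 𝔤 → 𝔤 and E₄ : 𝔥 → 𝔥. Then (𝔤, g, J_g, E₁) and (𝔥, h, J_h, E₄) are hypersymplectic Lie algebras, and φ(A)^s = 0 for all A ∈ 𝔥. -/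

import Mathlib

open Module

/-- A pseudo-Kähler Lie algebra structure. -/
def IsPseudoKahler (L : Type*) [LieRing L] [LieAlgebra ℝ L] [FiniteDimensional ℝ L]
    (g : L →ₗ[ℝ] L →ₗ[ℝ] ℝ) (J : Module.End ℝ L) : Prop :=
  (∀ x y, g x y = g y x) ∧
  (∀ x, (∀ y, g x y = 0) → x = 0) ∧
  (J ∘ₗ J = -1) ∧
  (∀ x y, g (J x) (J y) = g x y) ∧
  ∀ lc : L →ₗ[ℝ] L →ₗ[ℝ] L,
    (∀ x y z, 2 * g (lc x y) z = g ⁅x, y⁆ z - g y ⁅x, z⁆ - g x ⁅y, z⁆) →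
    ∀ x y, lc x (J y) = J (lc x y)

/-- A hypersymplectic Lie algebra structure: a pseudo-Kähler structure `(g, J)`
together with a compatible parallel almost para-complex structure `E`. -/
def IsHypersymplectic (L : Type*) [LieRing L] [LieAlgebra ℝ L] [FiniteDimensional ℝ L]
    (g : L →ₗ[ℝ] L →ₗ[ℝ] ℝ) (J E : Module.End ℝ L) : Prop :=
  IsPseudoKahler L g J ∧
  (E ∘ₗ E = 1) ∧
  (J ∘ₗ E = -(E ∘ₗ J)) ∧
  (∀ x y, g (E x) (E y) = -(g x y)) ∧
  ∀ lc : L →ₗ[ℝ] L →ₗ[ℝ] L,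
    (∀ x y z, 2 * g (lc x y) z = g ⁅x, y⁆ z - g y ⁅x, z⁆ - g x ⁅y, z⁆) →
    ∀ x y, lc x (E y) = E (lc x y)

/-- The right-hand side of the Koszul formula for a left-invariant metric. -/
def koszulForm {L : Type*} [LieRing L] [LieAlgebra ℝ L]
    (g : L →ₗ[ℝ] L →ₗ[ℝ] ℝ) (x y z : L) : ℝ :=
  g ⁅x, y⁆ z - g y ⁅x, z⁆ - g x ⁅y, z⁆

section Koszul

variable {L : Type*} [LieRing L] [LieAlgebra ℝ L] {g : L →ₗ[ℝ] L →ₗ[ℝ] ℝ}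

/-- A nondegenerate metric on a finite-dimensional Lie algebra has a Levi-Civita connection. -/
theorem exists_leviCivita [FiniteDimensional ℝ L] (hg : ∀ x, (∀ y, g x y = 0) → x = 0) :
    ∃ lc : L →ₗ[ℝ] L →ₗ[ℝ] L, ∀ x y z, 2 * g (lc x y) z = koszulForm g x y z := by
  have hinj : Function.Injective g := by
    rw [injective_iff_map_eq_zero]
    intro x hx
    exact hg x fun y => by rw [hx]; rfl
  let e : L ≃ₗ[ℝ] Dual ℝ L :=
    LinearMap.linearEquivOfInjective g hinj Subspace.dual_finrank_eq.symm
  have he : ∀ f z, g (e.symm f) z = f z := fun f z => by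
    have : g (e.symm f) = f := e.apply_symm_apply f
    rw [this]
  let k : L → L → Dual ℝ L := fun x y =>
    (2⁻¹ : ℝ) • (g ⁅x, y⁆ - g y ∘ₗ LieAlgebra.ad ℝ L x - g x ∘ₗ LieAlgebra.ad ℝ L y)
  have hk : ∀ x y z, k x y z = 2⁻¹ * koszulForm g x y z := fun x y z => by
    simp [k, koszulForm]
  refine ⟨LinearMap.mk₂ ℝ (fun x y => e.symm (k x y)) ?_ ?_ ?_ ?_, ?_⟩
  · intro x x' y
    rw [← map_add]
    congr 1
    ext z
    simp only [hk, LinearMap.add_apply, koszulForm, add_lie, map_add]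
    ring
  · intro c x y
    rw [← map_smul]
    congr 1
    ext z
    simp only [hk, LinearMap.smul_apply, koszulForm, smul_lie, map_smul, smul_eq_mul]
    ring
  · intro x y y'
    rw [← map_add]
    congr 1
    ext z
    simp only [hk, LinearMap.add_apply, koszulForm, lie_add, add_lie, map_add]
    ring
  · intro c x y
    rw [← map_smul]
    congr 1
    ext z
    simp only [hk, LinearMap.smul_apply, koszulForm, lie_smul, smul_lie, map_smul, smul_eq_mul]
    ring
  · intro x y z
    rw [LinearMap.mk₂_apply, he, hk]
    ring

/-- A skew-adjoint endomorphism commuting with the Levi-Civita connection is skew for the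
Koszul form. -/
theorem koszulForm_skew_of_parallel [FiniteDimensional ℝ L]
    (hg : ∀ x, (∀ y, g x y = 0) → x = 0) {F : Module.End ℝ L}
    (hF : ∀ x y, g (F x) y = -g x (F y))
    (hpar : ∀ lc : L →ₗ[ℝ] L →ₗ[ℝ] L,
      (∀ x y z, 2 * g (lc x y) z = koszulForm g x y z) → ∀ x y, lc x (F y) = F (lc x y))
    (x y z : L) : koszulForm g x (F y) z = -koszulForm g x y (F z) := by
  obtain ⟨lc, hlc⟩ := exists_leviCivita hg
  rw [← hlc, ← hlc, hpar lc hlc, hF]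
  ring

/-- A skew-adjoint endomorphism that is skew for the Koszul form commutes with the Levi-Civita
connection. -/
theorem parallel_of_koszulForm_skew
    (hg : ∀ x, (∀ y, g x y = 0) → x = 0) {F : Module.End ℝ L}
    (hF : ∀ x y, g (F x) y = -g x (F y))
    (hskew : ∀ x y z, koszulForm g x (F y) z = -koszulForm g x y (F z))
    (lc : L →ₗ[ℝ] L →ₗ[ℝ] L) (hlc : ∀ x y z, 2 * g (lc x y) z = koszulForm g x y z)
    (x y : L) : lc x (F y) = F (lc x y) := by
  refine sub_eq_zero.1 (hg _ fun z => ?_)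
  have h := hskew x y z
  rw [← hlc, ← hlc] at h
  rw [map_sub, LinearMap.sub_apply, hF]
  linarith

end Koszul

/-- A family of symmetric bilinear forms on which two anticommuting structures `J`, `E` with
`J² = -1`, `E² = 1` move from the argument to the parameter vanishes. -/
theorem symm_forms_eq_zero {V W : Type*} [AddCommGroup V] [Module ℝ V]
    {J E : Module.End ℝ V} {J' E' : W → W}
    (hJ : ∀ x, J (J x) = -x) (hE : ∀ x, E (E x) = x) (hJE : ∀ x, J (E x) = -E (J x))
    {B : W → V → V → ℝ} (hsymm : ∀ c x y, B c x y = B c y x)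
    (hneg : ∀ c x y, B c (-x) y = -B c x y)
    (hBJ : ∀ c x y, B c x (J y) = -B (J' c) x y)
    (hBE : ∀ c x y, B c x (E y) = -B (E' c) x y) (c : W) (x y : V) : B c x y = 0 := by
  have moveJ : ∀ c x y, B c x (J y) = B c (J x) y := fun c x y => by
    rw [hBJ, hsymm _ x y, ← hBJ, hsymm]
  have moveE : ∀ c x y, B c x (E y) = B c (E x) y := fun c x y => by
    rw [hBE, hsymm _ x y, ← hBE, hsymm]
  have h1 : ∀ x y, B c (J (E x)) y = 0 := fun x y => by
    have h2 : B c x (J (E y)) = -B c (J (E x)) y := by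
      rw [moveJ, moveE, ← hneg, hJE, neg_neg]
    have h3 : B c x (J (E y)) = B c (J (E x)) y := by
      rw [hBJ, hBE, hsymm _ x y, ← hBE, ← hBJ, hsymm]
    linarith
  have h4 := h1 (J (E x)) y
  rwa [hJE (J (E x)), hJ, map_neg, neg_neg, hE] at h4

/-- if a pseudo-Kähler semidirect product `𝔤 ⋊_φ 𝔥` is hypersymplectic
with block-diagonal `Ẽ`, then both factors are hypersymplectic and `φ(A)^s = 0`. -/
theorem stmt_13
    (𝔤 𝔥 G : Type*)
    [LieRing 𝔤] [LieAlgebra ℝ 𝔤] [FiniteDimensional ℝ 𝔤]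
    [LieRing 𝔥] [LieAlgebra ℝ 𝔥] [FiniteDimensional ℝ 𝔥]
    [LieRing G] [LieAlgebra ℝ G] [FiniteDimensional ℝ G]
    (g : 𝔤 →ₗ[ℝ] 𝔤 →ₗ[ℝ] ℝ) (Jg : Module.End ℝ 𝔤)
    (h : 𝔥 →ₗ[ℝ] 𝔥 →ₗ[ℝ] ℝ) (Jh : Module.End ℝ 𝔥)
    (hpkg : IsPseudoKahler 𝔤 g Jg) (hpkh : IsPseudoKahler 𝔥 h Jh)
    (φ : 𝔥 →ₗ[ℝ] Module.End ℝ 𝔤)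
    (hder : ∀ a x y, φ a ⁅x, y⁆ = ⁅φ a x, y⁆ + ⁅x, φ a y⁆)
    (hhom : ∀ a b, φ ⁅a, b⁆ = φ a ∘ₗ φ b - φ b ∘ₗ φ a)
    (adj : Module.End ℝ 𝔤 → Module.End ℝ 𝔤)
    (hadj : ∀ f x y, g (f x) y = g x (adj f y))
    (hext : ∀ a : 𝔥,
        Jg ∘ₗ ((2⁻¹ : ℝ) • (φ a + adj (φ a))) = (2⁻¹ : ℝ) • (φ (Jh a) + adj (φ (Jh a)))
        ∧ Jg ∘ₗ ((2⁻¹ : ℝ) • (φ a - adj (φ a))) = ((2⁻¹ : ℝ) • (φ a - adj (φ a))) ∘ₗ Jg)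
    (i : 𝔤 →ₗ[ℝ] G) (p : 𝔥 →ₗ[ℝ] G)
    (hbij : Function.Bijective fun q : 𝔤 × 𝔥 => i q.1 + p q.2)
    (hbrk : ∀ x a y b, ⁅i x + p a, i y + p b⁆
      = i ⁅x, y⁆ + i (φ a y) - i (φ b x) + p ⁅a, b⁆)
    (gt : G →ₗ[ℝ] G →ₗ[ℝ] ℝ)
    (hgt : ∀ x a y b, gt (i x + p a) (i y + p b) = g x y + h a b)
    (Jt : Module.End ℝ G)
    (hJt : ∀ x a, Jt (i x + p a) = i (Jg x) + p (Jh a))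
    -- Ẽ is block diagonal with components E₁ and E₄
    (E1 : Module.End ℝ 𝔤) (E4 : Module.End ℝ 𝔥)
    (Et : Module.End ℝ G)
    (hEt : ∀ x a, Et (i x + p a) = i (E1 x) + p (E4 a))
    (hHS : IsHypersymplectic G gt Jt Et) :
    IsHypersymplectic 𝔤 g Jg E1 ∧ IsHypersymplectic 𝔥 h Jh E4
      ∧ ∀ a : 𝔥, (2⁻¹ : ℝ) • (φ a + adj (φ a)) = 0 := by
  obtain ⟨gsymm, gnd, Jg2, -, -⟩ := id hpkg
  obtain ⟨-, hnd, -, -, -⟩ := id hpkh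
  obtain ⟨⟨-, tnd, Jt2, tJ, Jtpar⟩, Et2, JEt, tE, Etpar⟩ := hHS
  replace Jt2 : ∀ u, Jt (Jt u) = -u := fun u => LinearMap.congr_fun Jt2 u
  replace Jg2 : ∀ u, Jg (Jg u) = -u := fun u => LinearMap.congr_fun Jg2 u
  replace Et2 : ∀ u, Et (Et u) = u := fun u => LinearMap.congr_fun Et2 u
  replace JEt : ∀ u, Jt (Et u) = -Et (Jt u) := fun u => LinearMap.congr_fun JEt u
  have Jtskew : ∀ u v, gt (Jt u) v = -gt u (Jt v) := fun u v => by
    rw [← tJ (Jt u), Jt2, map_neg, LinearMap.neg_apply]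
  have Etskew : ∀ u v, gt (Et u) v = -gt u (Et v) := fun u v => by
    rw [← tE u, Et2]
  have KJ := koszulForm_skew_of_parallel tnd Jtskew Jtpar
  have KE := koszulForm_skew_of_parallel tnd Etskew Etpar
  have iinj : Function.Injective i := fun x y hxy => by
    simpa using @hbij.1 (x, 0) (y, 0) (by simp [hxy])
  have pinj : Function.Injective p := fun x y hxy => by
    simpa using @hbij.1 (0, x) (0, y) (by simp [hxy])
  have bii : ∀ x y, ⁅i x, i y⁆ = i ⁅x, y⁆ := fun x y => by simpa using hbrk x 0 y 0
  have bip : ∀ x b, ⁅i x, p b⁆ = -i (φ b x) := fun x b => by simpa using hbrk x 0 0 b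
  have bpp : ∀ a b, ⁅p a, p b⁆ = p ⁅a, b⁆ := fun a b => by simpa using hbrk 0 a 0 b
  have gii : ∀ x y, gt (i x) (i y) = g x y := fun x y => by simpa using hgt x 0 y 0
  have gip : ∀ x b, gt (i x) (p b) = 0 := fun x b => by simpa using hgt x 0 0 b
  have gpp : ∀ a b, gt (p a) (p b) = h a b := fun a b => by simpa using hgt 0 a 0 b
  have Ji : ∀ x, Jt (i x) = i (Jg x) := fun x => by simpa using hJt x 0
  have Jp : ∀ a, Jt (p a) = p (Jh a) := fun a => by simpa using hJt 0 a
  have Ei : ∀ x, Et (i x) = i (E1 x) := fun x => by simpa using hEt x 0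
  have Ep : ∀ a, Et (p a) = p (E4 a) := fun a => by simpa using hEt 0 a
  have Kiii : ∀ x y z, koszulForm gt (i x) (i y) (i z) = koszulForm g x y z := fun x y z => by
    simp only [koszulForm, bii, gii]
  have Kppp : ∀ a b c, koszulForm gt (p a) (p b) (p c) = koszulForm h a b c := fun a b c => by
    simp only [koszulForm, bpp, gpp]
  have Kiip : ∀ x y c, koszulForm gt (i x) (i y) (p c) = g y (φ c x) + g x (φ c y) :=
    fun x y c => by
      simp only [koszulForm, bii, bip, gii, gip, map_neg]
      ring
  have E12 : ∀ x, E1 (E1 x) = x := fun x => iinj <| by rw [← Ei, ← Ei, Et2]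
  have E42 : ∀ a, E4 (E4 a) = a := fun a => pinj <| by rw [← Ep, ← Ep, Et2]
  have JE1 : ∀ x, Jg (E1 x) = -E1 (Jg x) := fun x => iinj <| by
    rw [← Ji, ← Ei, JEt, Ji, Ei, map_neg]
  have JE4 : ∀ a, Jh (E4 a) = -E4 (Jh a) := fun a => pinj <| by
    rw [← Jp, ← Ep, JEt, Jp, Ep, map_neg]
  have E1skew : ∀ x y, g (E1 x) y = -g x (E1 y) := fun x y => by
    rw [← gii, ← gii, ← Ei, ← Ei, Etskew]
  have E4skew : ∀ a b, h (E4 a) b = -h a (E4 b) := fun a b => by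
    rw [← gpp, ← gpp, ← Ep, ← Ep, Etskew]
  refine ⟨⟨hpkg, LinearMap.ext E12, LinearMap.ext JE1, fun x y => by rw [E1skew, E12], ?_⟩,
    ⟨hpkh, LinearMap.ext E42, LinearMap.ext JE4, fun a b => by rw [E4skew, E42], ?_⟩,
    fun a => ?_⟩
  · refine parallel_of_koszulForm_skew gnd E1skew fun x y z => ?_
    rw [← Kiii, ← Kiii, ← Ei, ← Ei, KE]
  · refine parallel_of_koszulForm_skew hnd E4skew fun a b c => ?_
    rw [← Kppp, ← Kppp, ← Ep, ← Ep, KE]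
  · have hB := symm_forms_eq_zero (J := Jg) (E := E1) (J' := Jh) (E' := E4) Jg2 E12 JE1
      (B := fun c x y => g y (φ c x) + g x (φ c y)) (fun c x y => add_comm _ _)
      (fun c x y => by simp only [map_neg, LinearMap.neg_apply]; ring)
      (fun c x y => by simp only [← Kiip, ← Ji, ← Jp, KJ])
      (fun c x y => by simp only [← Kiip, ← Ei, ← Ep, KE]) a
    have hsum : φ a + adj (φ a) = 0 := by
      refine LinearMap.ext fun x => gnd _ fun y => ?_
      rw [LinearMap.add_apply, map_add, LinearMap.add_apply, gsymm (φ a x),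
        gsymm (adj (φ a) x), ← hadj, gsymm (φ a y)]
      exact hB x y
    rw [hsum, smul_zero]
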